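/- arXiv:1208.3362 — 2 statements merged into one kernel-verified Lean document; each statement's English description precedes it below -/
import Mathlib

section
/- Let C be a left-cancellative category, S a subfamily of its morphisms, and r ≥ 0. Every morphism g of C that is a composite of r elements of S♯ and that admits an S-normal decomposition satisfies ‖g‖_S ≤ r, i.e. every S-normal decomposition of g has at most r non-invertible entries. -/
open CategoryTheory

universe u v

namespace GarsideTest

variable {C : Type u} [Category.{v} C]

/-- `C` is left-cancellative. -/
def LeftCancellative (C : Type u) [Category.{v} C] : Prop :=
  ∀ ⦃x y z : C⦄ (f : x ⟶ y) (g g' : y ⟶ z), f ≫ g = f ≫ g' → g = g'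

/-- `f` left-divides `g`. -/
def LDiv {x y z : C} (f : x ⟶ y) (g : x ⟶ z) : Prop :=
  ∃ r : y ⟶ z, f ≫ r = g

/-- `f` properly left-divides `g` (`f ⊏ g`). -/
def LDivStrict {x y z : C} (f : x ⟶ y) (g : x ⟶ z) : Prop :=
  LDiv f g ∧ ¬ LDiv g f

/-- `f =× g` : `g` is obtained from `f` by right-multiplication by an invertible element. -/
def EqIr {x y z : C} (f : x ⟶ y) (g : x ⟶ z) : Prop :=
  ∃ e : y ⟶ z, IsIso e ∧ f ≫ e = g

/-- The family `S♯ = S C× ∪ C×`. -/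
def Sharp (S : MorphismProperty C) : MorphismProperty C :=
  fun x z g =>
    (∃ (y : C) (s : x ⟶ y) (e : y ⟶ z), S s ∧ IsIso e ∧ s ≫ e = g) ∨ IsIso g

/-- Composable paths of morphisms of `C`. -/
inductive Path {C : Type u} [Category.{v} C] : C → C → Type (max u v)
  | nil (x : C) : Path x x
  | cons {x y z : C} (g : x ⟶ y) (p : Path y z) : Path x z

namespace Path

/-- The composite of a path. -/
def comp : ∀ {x z : C}, Path x z → (x ⟶ z)
  | _, _, nil x => 𝟙 x
  | _, _, cons g p => g ≫ p.comp

/-- The length of a path. -/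
def length : ∀ {x z : C}, Path x z → ℕ
  | _, _, nil _ => 0
  | _, _, cons _ p => p.length + 1

/-- All entries of the path lie in `T`. -/
def Entries (T : MorphismProperty C) : ∀ {x z : C}, Path x z → Prop
  | _, _, nil _ => True
  | _, _, cons g p => T g ∧ Entries T p

/-- Concatenation of paths. -/
def append : ∀ {x y z : C}, Path x y → Path y z → Path x z
  | _, _, _, nil _, q => q
  | _, _, _, cons g p, q => cons g (p.append q)

open scoped Classical in
/-- Number of non-invertible entries of a path. -/
noncomputable def ninv : ∀ {x z : C}, Path x z → ℕ
  | _, _, nil _ => 0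
  | _, _, cons g p => (if IsIso g then 0 else 1) + p.ninv

end Path

/-- The length-two path `(g₁, g₂)` is `S`-greedy. -/
def Greedy2 (S : MorphismProperty C) {x y z : C} (g₁ : x ⟶ y) (g₂ : y ⟶ z) : Prop :=
  ∀ ⦃u w : C⦄ (f : u ⟶ x) (h : u ⟶ w), S h → LDiv h (f ≫ g₁ ≫ g₂) → LDiv h (f ≫ g₁)

/-- Auxiliary: the path `g :: p` is `S`-greedy. -/
def Path.GreedyFrom (S : MorphismProperty C) : ∀ {x y z : C}, (x ⟶ y) → Path y z → Prop
  | _, _, _, _, .nil _ => True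
  | _, _, _, g, .cons g' p => Greedy2 S g g' ∧ Path.GreedyFrom S g' p

/-- The path `p` is `S`-greedy. -/
def Path.Greedy (S : MorphismProperty C) : ∀ {x z : C}, Path x z → Prop
  | _, _, .nil _ => True
  | _, _, .cons g p => Path.GreedyFrom S g p

/-- The path `p` is `S`-normal: `S`-greedy with entries in `S♯`. -/
def Path.Normal (S : MorphismProperty C) {x z : C} (p : Path x z) : Prop :=
  p.Greedy S ∧ p.Entries (Sharp S)

/-- `p` is an `S`-normal decomposition of the morphism `g`. -/
def IsNormalDecomp (S : MorphismProperty C) {x z : C} (g : x ⟶ z) (p : Path x z) : Prop :=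
  p.Normal S ∧ p.comp = g

/-- `X` generates `C`. -/
def Generates (X : MorphismProperty C) : Prop :=
  ∀ ⦃x z : C⦄ (g : x ⟶ z), ∃ p : Path x z, p.Entries X ∧ p.comp = g

/-- `S` is a Garside family in `C`. -/
def IsGarside (S : MorphismProperty C) : Prop :=
  ∀ ⦃x z : C⦄ (g : x ⟶ z), ∃ p : Path x z, IsNormalDecomp S g p

/-- `Xʳ`: morphisms expressible as composites of `r` elements of `X`. -/
def MPow (X : MorphismProperty C) (r : ℕ) : MorphismProperty C :=
  fun x z g => ∃ p : Path x z, p.Entries X ∧ p.length = r ∧ p.comp = g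

/-- `X` is closed under right-complement. -/
def ClosedUnderRightComplement (X : MorphismProperty C) : Prop :=
  ∀ ⦃x y y' z : C⦄ (f : x ⟶ y) (g : x ⟶ y') (h : x ⟶ z), X f → X g →
    LDiv f h → LDiv g h →
    ∃ (w : C) (g' : y ⟶ w) (f' : y' ⟶ w),
      X g' ∧ X f' ∧ f ≫ g' = g ≫ f' ∧ LDiv (f ≫ g') h

/-- `X` is closed under right-comultiple. -/
def ClosedUnderRightComultiple (X : MorphismProperty C) : Prop :=
  ∀ ⦃x y y' z : C⦄ (f : x ⟶ y) (g : x ⟶ y') (h : x ⟶ z), X f → X g →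
    LDiv f h → LDiv g h →
    ∃ (w : C) (h' : x ⟶ w), X h' ∧ LDiv f h' ∧ LDiv g h' ∧ LDiv h' h

/-- `X` is closed under right-divisor. -/
def ClosedUnderRightDivisor (X : MorphismProperty C) : Prop :=
  ∀ ⦃x y z : C⦄ (f : x ⟶ y) (g : y ⟶ z), X (f ≫ g) → X g

/-- `g₁` is an `S`-head of `g`. -/
def IsHead (S : MorphismProperty C) {x w y : C} (g₁ : x ⟶ w) (g : x ⟶ y) : Prop :=
  S g₁ ∧ LDiv g₁ g ∧ ∀ ⦃w' : C⦄ (h : x ⟶ w'), S h → LDiv h g → LDiv h g₁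

/-- `h` is a right-lcm of `f` and `g`. -/
def IsRightLcm {x y y' w : C} (f : x ⟶ y) (g : x ⟶ y') (h : x ⟶ w) : Prop :=
  LDiv f h ∧ LDiv g h ∧ ∀ ⦃w' : C⦄ (h' : x ⟶ w'), LDiv f h' → LDiv g h' → LDiv h h'

/-- `X` is closed under right-lcm. -/
def ClosedUnderRightLcm (X : MorphismProperty C) : Prop :=
  ∀ ⦃x y y' w : C⦄ (f : x ⟶ y) (g : x ⟶ y') (h : x ⟶ w), X f → X g →
    IsRightLcm f g h → X h

/-- `C` is right-Noetherian: proper right-divisibility is well-founded. -/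
def RightNoetherian (C : Type u) [Category.{v} C] : Prop :=
  WellFounded (fun a b : Σ (x : C) (y : C), x ⟶ y =>
    ∃ (e : a.2.1 = b.2.1) (g' : b.1 ⟶ a.1), ¬ IsIso g' ∧ g' ≫ a.2.2 ≫ eqToHom e = b.2.2)

/-- `C` is left-Noetherian: proper left-divisibility is well-founded. -/
def LeftNoetherian (C : Type u) [Category.{v} C] : Prop :=
  WellFounded (fun a b : Σ (x : C) (y : C), x ⟶ y =>
    ∃ (e : b.1 = a.1) (g' : a.2.1 ⟶ b.2.1), ¬ IsIso g' ∧ eqToHom e ≫ a.2.2 ≫ g' = b.2.2)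

/-- `g` is an atom of `C`. -/
def IsAtomMor {x y : C} (g : x ⟶ y) : Prop :=
  ¬ IsIso g ∧ ∀ ⦃w : C⦄ (f : x ⟶ w) (h : w ⟶ y), f ≫ h = g → IsIso f ∨ IsIso h

/-- The only invertible morphisms of `C` are identities. -/
def NoNontrivialInvertible (C : Type u) [Category.{v} C] : Prop :=
  ∀ ⦃x y : C⦄ (e : x ⟶ y), IsIso e → ∃ h : x = y, e = eqToHom h

/-- Deformation by invertible elements, with a connecting morphism `e` at the left end. -/
inductive DeformRel : ∀ {xf xg z : C}, (xf ⟶ xg) → Path xf z → Path xg z → Prop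
  | nil (z : C) : DeformRel (𝟙 z) (.nil z) (.nil z)
  | cons {xf xg yf yg z : C} (e : xf ⟶ xg) (f : xf ⟶ yf) (g : xg ⟶ yg) (e' : yf ⟶ yg)
      {p : Path yf z} {q : Path yg z} :
      IsIso e' → e ≫ g = f ≫ e' → DeformRel e' p q →
      DeformRel e (.cons f p) (.cons g q)
  | padF {xg yg z : C} (e : z ⟶ xg) (g : xg ⟶ yg) (e' : z ⟶ yg) {q : Path yg z} :
      IsIso e' → e ≫ g = e' → DeformRel e' (.nil z) q →
      DeformRel e (.nil z) (.cons g q)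
  | padG {xf yf z : C} (e : xf ⟶ z) (f : xf ⟶ yf) (e' : yf ⟶ z) {p : Path yf z} :
      IsIso e' → e = f ≫ e' → DeformRel e' p (.nil z) →
      DeformRel e (.cons f p) (.nil z)

/-- `p` is a `C×`-deformation of `q`. -/
def IsDeformation {x z : C} (p q : Path x z) : Prop :=
  DeformRel (𝟙 x) p q

theorem Greedy2.ldiv_of_sharp {S : MorphismProperty C} {x y z u w : C} {g₁ : x ⟶ y}
    {g₂ : y ⟶ z} (hg : Greedy2 S g₁ g₂) (f : u ⟶ x) (h : u ⟶ w) (hh : Sharp S h)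
    (hd : LDiv h (f ≫ g₁ ≫ g₂)) : LDiv h (f ≫ g₁) := by
  rcases hh with ⟨y', s, e, hs, he, rfl⟩ | he
  · obtain ⟨a, ha⟩ := hd
    obtain ⟨b, hb⟩ := hg f s hs ⟨e ≫ a, by rw [← ha, Category.assoc]⟩
    exact ⟨inv e ≫ b, by simp [hb]⟩
  · exact ⟨inv h ≫ f ≫ g₁, by simp⟩

namespace Path

theorem GreedyFrom.ldiv_of_sharp {S : MorphismProperty C} {x y z u w : C} {g : x ⟶ y}
    {p : Path y z} (hp : GreedyFrom S g p) (f : u ⟶ x) (h : u ⟶ w) (hh : Sharp S h)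
    (hd : LDiv h (f ≫ g ≫ p.comp)) : LDiv h (f ≫ g) := by
  induction p generalizing x with
  | nil => simpa [comp] using hd
  | cons g' p ih =>
    refine hp.1.ldiv_of_sharp f h hh ?_
    simpa using ih hp.2 (f ≫ g) (by simpa [comp] using hd)

theorem GreedyFrom.greedy {S : MorphismProperty C} {x y z : C} {g : x ⟶ y}
    {p : Path y z} (hp : GreedyFrom S g p) : p.Greedy S := by
  cases p with
  | nil => trivial
  | cons g' p => exact hp.2

/-- If a composite of `r` entries of `S♯` left-divides `f` followed by a greedy path, it already
left-divides `f` followed by an initial segment of that path of length at most `r`. -/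
theorem Greedy.exists_append_of_ldiv (hC : LeftCancellative C) {S : MorphismProperty C}
    {u w x z : C} (q : Path u w) (hq : q.Entries (Sharp S)) (p : Path x z) (hp : p.Greedy S)
    (f : u ⟶ x) (hd : LDiv q.comp (f ≫ p.comp)) :
    ∃ (y : C) (p₁ : Path x y) (p₂ : Path y z), p₁.append p₂ = p ∧ p₁.length ≤ q.length ∧
      LDiv q.comp (f ≫ p₁.comp) := by
  induction q generalizing x with
  | nil => exact ⟨x, nil x, p, rfl, le_rfl, f, by simp [comp]⟩
  | cons h q ih =>
    cases p with
    | nil => exact ⟨_, nil _, nil _, rfl, Nat.zero_le _, hd⟩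
    | cons g p =>
      obtain ⟨a, ha⟩ := hd
      simp only [comp, Category.assoc] at ha
      obtain ⟨f', hf'⟩ := GreedyFrom.ldiv_of_sharp hp f h hq.1 ⟨_, ha⟩
      have hd' : LDiv q.comp (f' ≫ p.comp) :=
        ⟨a, hC h _ _ (by rw [ha, ← Category.assoc h, hf', Category.assoc])⟩
      obtain ⟨y, p₁, p₂, rfl, hl, b, hb⟩ := ih hq.2 p (GreedyFrom.greedy hp) f' hd'
      refine ⟨y, cons g p₁, p₂, rfl, Nat.succ_le_succ hl, b, ?_⟩
      simp only [comp, Category.assoc]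
      rw [hb, ← Category.assoc, hf', Category.assoc]

theorem comp_append {x y z : C} (p : Path x y) (q : Path y z) :
    (p.append q).comp = p.comp ≫ q.comp := by
  induction p with
  | nil => simp [append, comp]
  | cons g p ih => simp [append, comp, ih]

theorem ninv_append {x y z : C} (p : Path x y) (q : Path y z) :
    (p.append q).ninv = p.ninv + q.ninv := by
  induction p with
  | nil => simp [append, ninv]
  | cons g p ih => simp [append, ninv, ih, add_assoc]

theorem ninv_le_length {x z : C} (p : Path x z) : p.ninv ≤ p.length := by
  induction p with
  | nil => exact le_rfl
  | cons g p ih =>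
    simp only [ninv, length]
    split_ifs <;> omega

end Path

theorem LeftCancellative.isIso_of_comp_eq_id (hC : LeftCancellative C) {x y : C}
    {a : x ⟶ y} {b : y ⟶ x} (h : a ≫ b = 𝟙 x) : IsIso a :=
  ⟨b, h, hC a _ _ (by rw [← Category.assoc, h, Category.id_comp, Category.comp_id])⟩

theorem Path.ninv_eq_zero_of_comp_eq_id (hC : LeftCancellative C) {x z : C} (p : Path x z)
    (b : z ⟶ x) (h : p.comp ≫ b = 𝟙 x) : p.ninv = 0 := by
  induction p with
  | nil => rfl
  | cons g p ih =>
    simp only [Path.comp, Category.assoc] at h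
    have hg : IsIso g := hC.isIso_of_comp_eq_id h
    have h' : p.comp ≫ b ≫ g = 𝟙 _ :=
      hC g _ _ (by simpa using congrArg (· ≫ g) h)
    simp [Path.ninv, hg, ih _ h']

theorem stmt6 {C : Type u} [Category.{v} C] (hC : LeftCancellative C)
    (S : MorphismProperty C) {x z : C} (g : x ⟶ z) (r : ℕ)
    (hg : MPow (Sharp S) r g) (p : Path x z) (hp : IsNormalDecomp S g p) :
    p.ninv ≤ r := by
  obtain ⟨q, hq, rfl, hqg⟩ := hg
  obtain ⟨⟨hgr, -⟩, hpg⟩ := hp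
  obtain ⟨y, p₁, p₂, rfl, hl, b, hb⟩ := hgr.exists_append_of_ldiv hC q hq p (𝟙 x)
    ⟨𝟙 z, by simp [hqg, hpg]⟩
  rw [Path.comp_append] at hpg
  have h₂ : p₂.comp ≫ b = 𝟙 y := hC p₁.comp _ _ (by
    rw [← Category.assoc, hpg, ← hqg, hb, Category.id_comp, Category.comp_id])
  rw [Path.ninv_append, p₂.ninv_eq_zero_of_comp_eq_id hC b h₂]
  exact p₁.ninv_le_length.trans hl

end GarsideTest
end

section
/- Let C be a left-cancellative category that is right-Noetherian. A subfamily S of the morphisms of C is a Garside family if and only if S♯ generates C and S♯ is closed under right-comultiple and closed under right-divisor. -/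
open CategoryTheory

universe u v

namespace GarsideTest

variable {C : Type u} [Category.{v} C]

lemma LDiv.trans {w x y z : C} {f : w ⟶ x} {g : w ⟶ y} {h : w ⟶ z} (hfg : LDiv f g)
    (hgh : LDiv g h) : LDiv f h := by
  obtain ⟨r, rfl⟩ := hfg
  obtain ⟨s, rfl⟩ := hgh
  exact ⟨r ≫ s, by simp⟩

lemma LDiv.comp_left {w x y z : C} (k : w ⟶ x) {f : x ⟶ y} {g : x ⟶ z} (h : LDiv f g) :
    LDiv (k ≫ f) (k ≫ g) := by
  obtain ⟨r, rfl⟩ := h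
  exact ⟨r, by simp⟩

lemma LDiv.of_comp_left (hC : LeftCancellative C) {w x y z : C} {k : w ⟶ x} {f : x ⟶ y}
    {g : x ⟶ z} (h : LDiv (k ≫ f) (k ≫ g)) : LDiv f g := by
  obtain ⟨r, hr⟩ := h
  exact ⟨r, hC k _ _ (by simpa using hr)⟩

/-- In a left-cancellative category, a left-divisor of an invertible morphism is invertible. -/
lemma LDiv.isIso (hC : LeftCancellative C) {x y z : C} {f : x ⟶ y} {g : x ⟶ z} [IsIso g]
    (h : LDiv f g) : IsIso f := by
  obtain ⟨r, hr⟩ := h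
  have h1 : f ≫ r ≫ inv g = 𝟙 x := by
    rw [← Category.assoc, hr, IsIso.hom_inv_id]
  exact ⟨r ≫ inv g, h1, hC f _ _ (by rw [← Category.assoc, h1]; simp)⟩

/-- In a left-cancellative category, morphisms that left-divide each other differ by an
invertible right factor. -/
lemma isIso_of_lDiv_comp (hC : LeftCancellative C) {x y z : C} {f : x ⟶ y} {r : y ⟶ z}
    (h : LDiv (f ≫ r) f) : IsIso r := by
  have h' : LDiv r (𝟙 y) := LDiv.of_comp_left hC (k := f) (by simpa using h)
  exact h'.isIso hC

lemma sharp_of_isIso (S : MorphismProperty C) {x y : C} (e : x ⟶ y) [he : IsIso e] :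
    Sharp S e :=
  Or.inr he

lemma Sharp.comp_isIso {S : MorphismProperty C} {x y z : C} {f : x ⟶ y} (hf : Sharp S f)
    (e : y ⟶ z) [IsIso e] : Sharp S (f ≫ e) := by
  obtain ⟨w, s, e', hs, he', rfl⟩ | hf := hf
  · exact Or.inl ⟨w, s, e' ≫ e, hs, inferInstance, by simp⟩
  · exact Or.inr inferInstance

/-- An `S`-greedy pair is also greedy with respect to `S♯`. -/
lemma Greedy2.sharp {S : MorphismProperty C} {x y z : C} {g₁ : x ⟶ y} {g₂ : y ⟶ z}
    (h : Greedy2 S g₁ g₂) : Greedy2 (Sharp S) g₁ g₂ := by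
  rintro u w f k (⟨v, s, e, hs, he, rfl⟩ | hk) hdiv
  · obtain ⟨r, hr⟩ := h f s hs (LDiv.trans ⟨e, rfl⟩ hdiv)
    exact ⟨inv e ≫ r, by simpa using hr⟩
  · exact ⟨inv k ≫ f ≫ g₁, by simp⟩

lemma Greedy2.of_sharp {S : MorphismProperty C} {x y z : C} {g₁ : x ⟶ y} {g₂ : y ⟶ z}
    (h : Greedy2 (Sharp S) g₁ g₂) : Greedy2 S g₁ g₂ :=
  fun _ _ f k hk hdiv => h f k (Or.inl ⟨_, k, 𝟙 _, hk, inferInstance, by simp⟩) hdiv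

/-- The first entry of an `S`-greedy path is greedy with respect to the composite of the rest. -/
lemma Path.GreedyFrom.greedy2_comp {S : MorphismProperty C} {x y z : C} {g : x ⟶ y}
    {p : Path y z} (hp : Path.GreedyFrom S g p) : Greedy2 S g p.comp := by
  induction p generalizing x with
  | nil y =>
    intro u w f h _ hdiv
    simpa [Path.comp] using hdiv
  | cons g' p ih =>
    intro u w f h hh hdiv
    refine hp.1 f h hh ?_
    simpa using ih hp.2 (f ≫ g) h hh (by simpa [Path.comp] using hdiv)

/-- Every morphism of a category with a Garside family `S` splits as an element of `S♯` followed
by a morphism, in a greedy way. -/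
lemma IsGarside.exists_greedy2 {S : MorphismProperty C} (hS : IsGarside S) {x z : C}
    (g : x ⟶ z) : ∃ (y : C) (g₁ : x ⟶ y) (g₂ : y ⟶ z),
      Sharp S g₁ ∧ g₁ ≫ g₂ = g ∧ Greedy2 (Sharp S) g₁ g₂ := by
  obtain ⟨p, ⟨hgr, hent⟩, rfl⟩ := hS g
  cases p with
  | nil => exact ⟨x, 𝟙 x, 𝟙 x, sharp_of_isIso S _, by simp [Path.comp],
      fun _ _ f h _ hdiv => by simpa using hdiv⟩
  | cons g₁ p =>
    exact ⟨_, g₁, p.comp, hent.1, rfl, (Path.GreedyFrom.greedy2_comp hgr).sharp⟩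

lemma IsGarside.generates {S : MorphismProperty C} (hS : IsGarside S) : Generates (Sharp S) :=
  fun _ _ g => let ⟨p, hp, hpg⟩ := hS g; ⟨p, hp.2, hpg⟩

lemma IsGarside.closedUnderRightComultiple {S : MorphismProperty C} (hS : IsGarside S) :
    ClosedUnderRightComultiple (Sharp S) := by
  intro x y y' z f g h hf hg hfh hgh
  obtain ⟨w, h₁, h₂, hh₁, rfl, hgr⟩ := hS.exists_greedy2 h
  refine ⟨w, h₁, hh₁, ?_, ?_, ⟨h₂, rfl⟩⟩
  · simpa using hgr (𝟙 x) f hf (by simpa using hfh)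
  · simpa using hgr (𝟙 x) g hg (by simpa using hgh)

lemma IsGarside.closedUnderRightDivisor (hC : LeftCancellative C) {S : MorphismProperty C}
    (hS : IsGarside S) : ClosedUnderRightDivisor (Sharp S) := by
  intro x y z f g hfg
  obtain ⟨w, g₁, g₂, hg₁, rfl, hgr⟩ := hS.exists_greedy2 g
  have hdiv : LDiv (g₁ ≫ g₂) g₁ :=
    LDiv.of_comp_left hC (hgr f _ hfg ⟨𝟙 z, by simp⟩)
  have := isIso_of_lDiv_comp hC hdiv
  exact hg₁.comp_isIso g₂

/-- In a right-Noetherian category, a morphism whose `X`-left-divisors admit common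
right-multiples within `X` has an `X`-head. -/
lemma exists_isHead (hC : LeftCancellative C) (hN : RightNoetherian C) {X : MorphismProperty C}
    (hid : ∀ x : C, X (𝟙 x)) (hX : ClosedUnderRightComultiple X) {x z : C} (g : x ⟶ z) :
    ∃ (y : C) (g₁ : x ⟶ y), IsHead X g₁ g := by
  obtain ⟨_, ⟨y, h, r, hh, rfl, rfl⟩, hmin⟩ := hN.has_min
    {b | ∃ (y : C) (h : x ⟶ y) (r : y ⟶ z), X h ∧ h ≫ r = g ∧ b = ⟨y, z, r⟩}
    ⟨_, x, 𝟙 x, g, hid x, by simp, rfl⟩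
  refine ⟨y, h, hh, ⟨r, rfl⟩, fun w k hk hkg => ?_⟩
  obtain ⟨v, m, hm, ⟨t, rfl⟩, hkm, ⟨s, hs⟩⟩ := hX h k (h ≫ r) hh hk ⟨r, rfl⟩ hkg
  have hts : t ≫ s = r := hC h _ _ (by simpa using hs)
  have ht : IsIso t := by
    by_contra ht
    exact hmin _ ⟨v, h ≫ t, s, hm, hs, rfl⟩ ⟨rfl, t, ht, by simpa using hts⟩
  exact hkm.trans ⟨inv t, by simp⟩

/-- If `X` generates and is closed under right-comultiple and right-divisor, then an `X`-head of
`g` is `X`-greedy with respect to its complement in `g`. -/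
lemma IsHead.greedy2 (hC : LeftCancellative C) {X : MorphismProperty C} (hgen : Generates X)
    (hcm : ClosedUnderRightComultiple X) (hrd : ClosedUnderRightDivisor X) {x y z : C}
    {g₁ : x ⟶ y} {g₂ : y ⟶ z} (hg : IsHead X g₁ (g₁ ≫ g₂)) : Greedy2 X g₁ g₂ := by
  intro u w f h hh hdiv
  obtain ⟨p, hp, rfl⟩ := hgen f
  induction p generalizing w with
  | nil => simpa [Path.comp] using hg.2.2 h hh (by simpa [Path.comp] using hdiv)
  | cons f₁ p ih =>
    simp only [Path.comp, Category.assoc] at hdiv ⊢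
    obtain ⟨v, m, hm, ⟨k, rfl⟩, hhm, hmg⟩ := hcm f₁ h _ hp.1 hh ⟨_, rfl⟩ hdiv
    exact hhm.trans ((ih hg k (hrd _ _ hm) hp.2 (hmg.of_comp_left hC)).comp_left f₁)

/-- If `X` generates, then a morphism with an invertible greedy first factor is invertible. -/
lemma Greedy2.isIso_of_isIso (hC : LeftCancellative C) {X : MorphismProperty C}
    (hgen : Generates X) {x y z : C} {g₁ : x ⟶ y} {g₂ : y ⟶ z} (hgr : Greedy2 X g₁ g₂)
    [IsIso g₁] : IsIso (g₁ ≫ g₂) := by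
  have key : ∀ {u z : C} (p : Path u z), p.Entries X → ∀ (f : u ⟶ x) (g₂ : y ⟶ z), IsIso f →
      Greedy2 X g₁ g₂ → f ≫ g₁ ≫ g₂ = p.comp → IsIso p.comp := by
    intro u z p
    induction p with
    | nil => intros; exact inferInstanceAs (IsIso (𝟙 _))
    | cons k p ih =>
      intro hp f g₂ hf hgr heq
      have hk : IsIso k := (hgr f k hp.1 ⟨p.comp, heq.symm⟩).isIso hC
      have : IsIso p.comp := ih hp.2 (inv k ≫ f) g₂ inferInstance hgr (by simp [heq, Path.comp])
      exact inferInstanceAs (IsIso (k ≫ p.comp))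
  obtain ⟨p, hp, hpg⟩ := hgen (g₁ ≫ g₂)
  rw [← hpg]
  exact key p hp (𝟙 x) g₂ inferInstance hgr (by simp [hpg])

lemma Path.Normal.cons {S : MorphismProperty C} {x y z : C} {g : x ⟶ y} {p : Path y z}
    (hg : Sharp S g) (hp : p.Normal S) (hgr : Greedy2 S g p.comp) :
    (Path.cons g p).Normal S := by
  refine ⟨?_, hg, hp.2⟩
  cases p with
  | nil => trivial
  | cons g' p =>
    exact ⟨fun u w f h hh hdiv => hgr f h hh (hdiv.trans ⟨p.comp, by simp [Path.comp]⟩), hp.1⟩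

lemma isGarside_of_closedUnder (hC : LeftCancellative C) (hN : RightNoetherian C)
    {S : MorphismProperty C} (hgen : Generates (Sharp S))
    (hcm : ClosedUnderRightComultiple (Sharp S)) (hrd : ClosedUnderRightDivisor (Sharp S)) :
    IsGarside S := by
  suffices h : ∀ b : Σ (x : C) (z : C), x ⟶ z, ∃ p : Path b.1 b.2.1, IsNormalDecomp S b.2.2 p from
    fun x z g => h ⟨x, z, g⟩
  intro b
  induction b using hN.induction with
  | _ b ih =>
    obtain ⟨x, z, g⟩ := b
    by_cases hg : IsIso g
    · exact ⟨.cons g (.nil z), ⟨trivial, sharp_of_isIso S g, trivial⟩, by simp [Path.comp]⟩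
    obtain ⟨y, g₁, hhead⟩ := exists_isHead hC hN (fun x => sharp_of_isIso S (𝟙 x)) hcm g
    obtain ⟨g₂, rfl⟩ := hhead.2.1
    have hgr := hhead.greedy2 hC hgen hcm hrd
    have hg₁ : ¬ IsIso g₁ := fun _ => hg (hgr.isIso_of_isIso hC hgen)
    obtain ⟨p, hp, hpg⟩ := ih ⟨y, z, g₂⟩ ⟨rfl, g₁, hg₁, by simp⟩
    dsimp only at p hp hpg
    subst hpg
    exact ⟨.cons g₁ p, hp.cons hhead.1 hgr.of_sharp, rfl⟩

theorem stmt13 {C : Type u} [Category.{v} C] (hC : LeftCancellative C)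
    (hN : RightNoetherian C) (S : MorphismProperty C) :
    IsGarside S ↔
      (Generates (Sharp S) ∧ ClosedUnderRightComultiple (Sharp S) ∧
        ClosedUnderRightDivisor (Sharp S)) := by
  exact ⟨fun hS => ⟨hS.generates, hS.closedUnderRightComultiple, hS.closedUnderRightDivisor hC⟩,
    fun ⟨hgen, hcm, hrd⟩ => isGarside_of_closedUnder hC hN hgen hcm hrd⟩

end GarsideTest
end
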